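/- Fix θ ∈ ℂ and let g : ℕ → ℂ satisfy ∑_{p ≤ t, p prime} g(p) = θ t / log t + E_g(t) where E_g(t) = o(t / log t) as t → ∞ and ∫_2^∞ |E_g(t)| t^{-2} dt < ∞. Then for every fixed c ≥ 0, for s in any compact subset of ℝ and uniformly in y ≥ 3, ∑_{p ≤ y} g(p) p^{-(1 + c/log y)} cos(s log p) = θ log[min(|s|^{-1}, log y)] + O(1). -/

import Mathlib

open Filter MeasureTheory

/-- `π_g(t) = ∑_{p ≤ t} g(p)`, the sum over primes up to the real number `t`. -/
noncomputable def primeSum (g : ℕ → ℂ) (t : ℝ) : ℂ :=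
  ∑ p ∈ Nat.primesBelow (⌊t⌋₊ + 1), g p

/-- The damped cosine `e^{-au} cos (su)`. -/
noncomputable def dampedCos (a s u : ℝ) : ℝ :=
  Real.exp (-(a * u)) * Real.cos (s * u)

/-- The derivative of `dampedCos a s`. -/
noncomputable def dampedCosDeriv (a s u : ℝ) : ℝ :=
  -(a * (Real.exp (-(a * u)) * Real.cos (s * u))) - s * (Real.exp (-(a * u)) * Real.sin (s * u))

lemma continuous_dampedCos (a s : ℝ) : Continuous (dampedCos a s) := by
  unfold dampedCos; fun_prop

lemma continuous_dampedCosDeriv (a s : ℝ) : Continuous (dampedCosDeriv a s) := by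
  unfold dampedCosDeriv; fun_prop

lemma hasDerivAt_exp_neg_mul (a u : ℝ) :
    HasDerivAt (fun u : ℝ => Real.exp (-(a * u))) (-(a * Real.exp (-(a * u)))) u := by
  refine HasDerivAt.congr_deriv (((hasDerivAt_id u).const_mul a).neg).exp ?_
  simp [mul_comm]

lemma hasDerivAt_dampedCos (a s u : ℝ) :
    HasDerivAt (dampedCos a s) (dampedCosDeriv a s u) u := by
  refine ((hasDerivAt_exp_neg_mul a u).mul ((hasDerivAt_id u).const_mul s).cos).congr_deriv ?_
  simp [dampedCosDeriv]; ring

lemma exp_neg_mul_le_one {a u : ℝ} (ha : 0 ≤ a) (hu : 0 ≤ u) : Real.exp (-(a * u)) ≤ 1 :=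
  Real.exp_le_one_iff.2 (neg_nonpos.2 (mul_nonneg ha hu))

lemma abs_exp_neg_mul_mul_le {a u x : ℝ} (ha : 0 ≤ a) (hu : 0 ≤ u) (hx : |x| ≤ 1) :
    |Real.exp (-(a * u)) * x| ≤ 1 := by
  rw [abs_mul, Real.abs_exp]
  exact mul_le_one₀ (exp_neg_mul_le_one ha hu) (abs_nonneg _) hx

lemma abs_dampedCos_le_one {a u : ℝ} (s : ℝ) (ha : 0 ≤ a) (hu : 0 ≤ u) :
    |dampedCos a s u| ≤ 1 :=
  abs_exp_neg_mul_mul_le ha hu (Real.abs_cos_le_one _)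

lemma abs_dampedCosDeriv_le {a u : ℝ} (s : ℝ) (ha : 0 ≤ a) (hu : 0 ≤ u) :
    |dampedCosDeriv a s u| ≤ a + |s| := by
  have h₁ := abs_exp_neg_mul_mul_le ha hu (Real.abs_cos_le_one (s * u))
  have h₂ := abs_exp_neg_mul_mul_le ha hu (Real.abs_sin_le_one (s * u))
  refine (abs_sub _ _).trans (add_le_add ?_ ?_)
  · rw [abs_neg, abs_mul, abs_of_nonneg ha]
    exact mul_le_of_le_one_right ha h₁
  · rw [abs_mul]
    exact mul_le_of_le_one_right (abs_nonneg s) h₂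

lemma abs_dampedCos_sub_one_le {a u : ℝ} (s : ℝ) (ha : 0 ≤ a) (hu : 0 ≤ u) :
    |dampedCos a s u - 1| ≤ (a + |s|) * u := by
  have h₁ : |Real.cos (s * u) - 1| ≤ |s| * u := by
    simpa [abs_mul, abs_of_nonneg hu] using Real.abs_cos_sub_cos_le (s * u) 0
  have h₂ : |Real.exp (-(a * u)) - 1| ≤ a * u := by
    rw [abs_sub_comm, abs_of_nonneg (sub_nonneg.2 (exp_neg_mul_le_one ha hu))]
    linarith [Real.one_sub_le_exp_neg (a * u)]
  have h₃ : dampedCos a s u - 1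
      = Real.exp (-(a * u)) * (Real.cos (s * u) - 1) + (Real.exp (-(a * u)) - 1) := by
    unfold dampedCos; ring
  rw [h₃]
  refine (abs_add_le _ _).trans ?_
  rw [abs_mul, Real.abs_exp]
  have h₄ := mul_le_of_le_one_left (abs_nonneg (Real.cos (s * u) - 1))
    (exp_neg_mul_le_one ha hu)
  linarith

lemma pos_of_mem_uIcc {b x u : ℝ} (hb : 0 < b) (hx : 0 < x) (hu : u ∈ Set.uIcc b x) : 0 < u :=
  (lt_min hb hx).trans_le hu.1

lemma intervalIntegrable_div_id {h : ℝ → ℝ} (hh : Continuous h) {b x : ℝ} (hb : 0 < b)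
    (hx : 0 < x) : IntervalIntegrable (fun u => h u / u) volume b x :=
  (hh.continuousOn.div continuousOn_id
    fun _ hu => (pos_of_mem_uIcc hb hx hu).ne').intervalIntegrable

/-- Before the oscillation and the damping set in, the integral of `dampedCos a s u / u` is
logarithmic. -/
lemma abs_integral_dampedCos_div_sub_log_le {a b x : ℝ} (s : ℝ) (ha : 0 ≤ a) (hb : 0 < b)
    (hx : 0 < x) :
    |(∫ u in b..x, dampedCos a s u / u) - Real.log (x / b)| ≤ (a + |s|) * |x - b| := by
  rw [← integral_inv_of_pos hb hx, ← intervalIntegral.integral_sub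
    (intervalIntegrable_div_id (continuous_dampedCos a s) hb hx)
    (by simpa using intervalIntegrable_div_id (continuous_const (y := (1 : ℝ))) hb hx),
    ← Real.norm_eq_abs]
  refine intervalIntegral.norm_integral_le_of_norm_le_const fun u hu => ?_
  have hu' : 0 < u := pos_of_mem_uIcc hb hx (Set.uIoc_subset_uIcc hu)
  rw [Real.norm_eq_abs, inv_eq_one_div, ← sub_div, abs_div, abs_of_pos hu', div_le_iff₀ hu']
  exact abs_dampedCos_sub_one_le s ha hu'.le

/-- Integration by parts bounds the oscillating tail of the integral of `dampedCos a s u / u`. -/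
lemma abs_integral_dampedCos_div_le {a s b x : ℝ} (ha : 0 ≤ a) (hs : s ≠ 0) (hb : 0 < b)
    (hbx : b ≤ x) :
    |∫ u in b..x, dampedCos a s u / u| ≤ 3 / (|s| * b) := by
  have hx : 0 < x := hb.trans_le hbx
  have hs' : 0 < |s| := abs_pos.2 hs
  set k : ℝ → ℝ := fun u => Real.exp (-(a * u)) / u with hk
  set k' : ℝ → ℝ := fun u => -(Real.exp (-(a * u)) * (a / u + 1 / u ^ 2)) with hk'
  have hkd : ∀ u, 0 < u → HasDerivAt k (k' u) u := fun u hu => by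
    refine ((hasDerivAt_exp_neg_mul a u).div (hasDerivAt_id u) hu.ne').congr_deriv ?_
    simp only [hk', id]; field_simp; ring
  have hkc : ContinuousOn k' (Set.uIcc b x) := by
    have h0 : ∀ u ∈ Set.uIcc b x, u ≠ 0 := fun u hu => (pos_of_mem_uIcc hb hx hu).ne'
    have h1 : ∀ u ∈ Set.uIcc b x, u ^ 2 ≠ 0 := fun u hu => pow_ne_zero 2 (h0 u hu)
    simp only [hk']
    fun_prop (disch := assumption)
  have hk0 : ∀ u, 0 < u → 0 ≤ k u := fun u hu => div_nonneg (Real.exp_pos _).le hu.le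
  have hS : ∀ u, HasDerivAt (fun u => Real.sin (s * u) / s) (Real.cos (s * u)) u := fun u => by
    refine ((((hasDerivAt_id u).const_mul s).sin).div_const s).congr_deriv ?_
    simp; field_simp
  have hSb : ∀ u, |Real.sin (s * u) / s| ≤ 1 / |s| := fun u => by
    rw [abs_div]; gcongr; exact Real.abs_sin_le_one _
  have hparts := intervalIntegral.integral_mul_deriv_eq_deriv_mul
    (u := k) (u' := k') (v := fun u => Real.sin (s * u) / s) (v' := fun u => Real.cos (s * u))
    (fun u hu => hkd u (pos_of_mem_uIcc hb hx hu)) (fun u _ => hS u)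
    hkc.intervalIntegrable
    ((by fun_prop : Continuous fun u => Real.cos (s * u)).intervalIntegrable _ _)
  have heq : (∫ u in b..x, dampedCos a s u / u) = ∫ u in b..x, k u * Real.cos (s * u) :=
    intervalIntegral.integral_congr fun u _ => by simp only [dampedCos, hk]; ring
  have hrem : |∫ u in b..x, k' u * (Real.sin (s * u) / s)| ≤ (k b - k x) * (1 / |s|) := by
    have hfund := intervalIntegral.integral_eq_sub_of_hasDerivAt
      (fun u hu => hkd u (pos_of_mem_uIcc hb hx hu)) hkc.intervalIntegrable
    have : (k b - k x) * (1 / |s|) = ∫ u in b..x, -k' u * (1 / |s|) := by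
      rw [intervalIntegral.integral_mul_const, intervalIntegral.integral_neg, hfund]; ring
    rw [this, ← Real.norm_eq_abs]
    refine intervalIntegral.norm_integral_le_of_norm_le hbx
      (Eventually.of_forall fun u hu => ?_) (hkc.neg.mul continuousOn_const).intervalIntegrable
    have hu0 : 0 < u := hb.trans hu.1
    have hk'0 : k' u ≤ 0 := neg_nonpos.2 (by positivity)
    rw [Real.norm_eq_abs, abs_mul, abs_of_nonpos hk'0]
    exact mul_le_mul_of_nonneg_left (hSb u) (neg_nonneg.2 hk'0)
  have hkb : k b ≤ 1 / b := by
    simp only [hk]; gcongr; exact exp_neg_mul_le_one ha hb.le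
  have hend : ∀ u, 0 < u → |k u * (Real.sin (s * u) / s)| ≤ k u * (1 / |s|) := fun u hu => by
    rw [abs_mul, abs_of_nonneg (hk0 u hu)]
    exact mul_le_mul_of_nonneg_left (hSb u) (hk0 u hu)
  rw [heq, hparts]
  have h₁ := abs_sub (k x * (Real.sin (s * x) / s) - k b * (Real.sin (s * b) / s))
    (∫ u in b..x, k' u * (Real.sin (s * u) / s))
  have h₂ := abs_sub (k x * (Real.sin (s * x) / s)) (k b * (Real.sin (s * b) / s))
  have h₃ : k b * (1 / |s|) ≤ 1 / b * (1 / |s|) := by gcongr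
  have h₄ : 3 / (|s| * b) = 3 * (1 / b * (1 / |s|)) := by field_simp
  linarith [hend x hx, hend b hb, mul_nonneg (hk0 b hb) (one_div_nonneg.2 hs'.le)]

/-- The cut-off `min (|s|⁻¹, L)`, interpreted as `L` at `s = 0`. -/
lemma abs_integral_dampedCos_div_sub_log_min_le {a s b L : ℝ} (ha : 0 ≤ a) (hb : 0 < b)
    (hL : 0 < L) :
    |(∫ u in b..L, dampedCos a s u / u) - Real.log (if s = 0 then L else min |s|⁻¹ L)|
      ≤ a * L + (a + |s|) * b + |Real.log b| + 4 := by
  set M := if s = 0 then L else min |s|⁻¹ L with hM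
  have hM0 : 0 < M := by
    rw [hM]; split_ifs with h
    · exact hL
    · exact lt_min (inv_pos.2 (abs_pos.2 h)) hL
  have hML : M ≤ L := by
    rw [hM]; split_ifs
    · exact le_rfl
    · exact min_le_right _ _
  have hsM : |s| * M ≤ 1 := by
    rw [hM]; split_ifs with h
    · simp [h]
    · exact (mul_le_mul_of_nonneg_left (min_le_left _ _) (abs_nonneg s)).trans
        (mul_inv_cancel₀ (abs_pos.2 h).ne').le
  have htail : |∫ u in M..L, dampedCos a s u / u| ≤ 3 := by
    rcases hML.eq_or_lt with h | h
    · simp [h]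
    · have hs : s ≠ 0 := fun h0 => h.ne (by simp [hM, h0])
      have hMs : M = |s|⁻¹ := by
        rw [hM, if_neg hs] at h ⊢
        exact min_eq_left (by by_contra! h'; exact h.ne (min_eq_right h'.le))
      refine (abs_integral_dampedCos_div_le ha hs hM0 hML).trans_eq ?_
      rw [hMs, mul_inv_cancel₀ (abs_pos.2 hs).ne', div_one]
  have hint := fun {x z : ℝ} => intervalIntegrable_div_id (continuous_dampedCos a s) (b := x) (x := z)
  have hsplit := intervalIntegral.integral_add_adjacent_intervals (hint hb hM0) (hint hM0 hL)
  have hhead := abs_integral_dampedCos_div_sub_log_le s ha hb hM0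
  rw [Real.log_div hM0.ne' hb.ne'] at hhead
  have hMb : |M - b| ≤ M + b := abs_le.2 ⟨by linarith, by linarith⟩
  have h₁ : (a + |s|) * |M - b| ≤ (a + |s|) * (M + b) := by gcongr
  have h₂ : a * M ≤ a * L := by gcongr
  rw [← hsplit]
  rw [abs_le] at hhead htail ⊢
  have := neg_abs_le (Real.log b)
  have := le_abs_self (Real.log b)
  constructor <;> linarith [hhead.1, hhead.2, htail.1, htail.2]

/-- The smooth weight `dampedCos a s (log t) / t` in the twisted prime sum. -/
lemma hasDerivAt_dampedCos_log_div {t : ℝ} (a s : ℝ) (ht : 0 < t) :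
    HasDerivAt (fun t => dampedCos a s (Real.log t) / t)
      ((dampedCosDeriv a s (Real.log t) - dampedCos a s (Real.log t)) / t ^ 2) t := by
  refine ((((hasDerivAt_dampedCos a s (Real.log t)).comp t
    (Real.hasDerivAt_log ht.ne')).div (hasDerivAt_id t) ht.ne')).congr_deriv ?_
  simp; field_simp

lemma integral_deriv_weight_mul_div_log {y : ℝ} (a s : ℝ) (hy : 2 ≤ y) :
    (∫ t in (2 : ℝ)..y, (dampedCosDeriv a s (Real.log t) - dampedCos a s (Real.log t)) / t ^ 2 *
        (t / Real.log t)) =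
      dampedCos a s (Real.log y) / Real.log y - dampedCos a s (Real.log 2) / Real.log 2 +
        (∫ u in Real.log 2..Real.log y, dampedCos a s u / u ^ 2) -
          ∫ u in Real.log 2..Real.log y, dampedCos a s u / u := by
  have hl2 : 0 < Real.log 2 := Real.log_pos one_lt_two
  have hly : 0 < Real.log y := Real.log_pos (by linarith)
  have hpos : ∀ t ∈ Set.uIcc 2 y, 0 < t := fun t => pos_of_mem_uIcc two_pos (by linarith)
  have hne : ∀ u ∈ Set.uIcc (Real.log 2) (Real.log y), u ≠ 0 :=
    fun u hu => (pos_of_mem_uIcc hl2 hly hu).ne'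
  have hne2 : ∀ u ∈ Set.uIcc (Real.log 2) (Real.log y), u ^ 2 ≠ 0 :=
    fun u hu => pow_ne_zero 2 (hne u hu)
  have hsub := intervalIntegral.integral_comp_mul_deriv' (a := 2) (b := y) (f := Real.log)
    (f' := fun t => t⁻¹) (g := fun u => (dampedCosDeriv a s u - dampedCos a s u) / u)
    (fun t ht => Real.hasDerivAt_log (hpos t ht).ne')
    (continuousOn_id.inv₀ fun t ht => (hpos t ht).ne')
    (((continuous_dampedCosDeriv a s).sub (continuous_dampedCos a s)).continuousOn.div
      continuousOn_id (by
        rintro _ ⟨t, ht, rfl⟩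
        rw [Set.uIcc_of_le hy] at ht
        exact (Real.log_pos (by linarith [ht.1])).ne'))
  have hleft : (∫ t in (2 : ℝ)..y,
      (dampedCosDeriv a s (Real.log t) - dampedCos a s (Real.log t)) / t ^ 2 * (t / Real.log t)) =
      ∫ t in (2 : ℝ)..y,
        ((fun u => (dampedCosDeriv a s u - dampedCos a s u) / u) ∘ Real.log) t * t⁻¹ :=
    intervalIntegral.integral_congr fun t ht => by
      have := (hpos t ht).ne'
      simp only [Function.comp]; field_simp
  have hi₁ := intervalIntegrable_div_id (continuous_dampedCosDeriv a s) hl2 hly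
  have hi₂ := intervalIntegrable_div_id (continuous_dampedCos a s) hl2 hly
  have hi₃ : IntervalIntegrable (fun u => dampedCos a s u / u ^ 2) volume
      (Real.log 2) (Real.log y) :=
    ((continuous_dampedCos a s).continuousOn.div (continuousOn_pow 2) hne2).intervalIntegrable
  have hfund := intervalIntegral.integral_eq_sub_of_hasDerivAt
    (f := fun u => dampedCos a s u / u)
    (f' := fun u => dampedCosDeriv a s u / u - dampedCos a s u / u ^ 2)
    (a := Real.log 2) (b := Real.log y) (fun u hu => by
      have := hne u hu
      refine ((hasDerivAt_dampedCos a s u).div (hasDerivAt_id u) this).congr_deriv ?_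
      simp; field_simp) (hi₁.sub hi₃)
  rw [intervalIntegral.integral_sub hi₁ hi₃] at hfund
  rw [hleft, hsub]
  simp only [sub_div]
  rw [intervalIntegral.integral_sub hi₁ hi₂]
  linarith

lemma abs_integral_dampedCos_div_sq_le {a b x : ℝ} (s : ℝ) (ha : 0 ≤ a) (hb : 0 < b)
    (hbx : b ≤ x) : |∫ u in b..x, dampedCos a s u / u ^ 2| ≤ 1 / b := by
  have hx := hb.trans_le hbx
  have hc : ContinuousOn (fun u : ℝ => 1 / u ^ 2) (Set.uIcc b x) :=
    continuousOn_const.div (continuousOn_pow 2)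
      fun u hu => pow_ne_zero 2 (pos_of_mem_uIcc hb hx hu).ne'
  have hfund := intervalIntegral.integral_eq_sub_of_hasDerivAt (f := fun u : ℝ => -u⁻¹)
    (f' := fun u : ℝ => 1 / u ^ 2) (a := b) (b := x) (fun u hu => by
      refine ((hasDerivAt_inv (pos_of_mem_uIcc hb hx hu).ne').neg).congr_deriv ?_
      simp) hc.intervalIntegrable
  have h := intervalIntegral.norm_integral_le_of_norm_le (μ := volume) hbx
    (f := fun u => dampedCos a s u / u ^ 2) (g := fun u : ℝ => 1 / u ^ 2)
    (Eventually.of_forall fun u hu => by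
      have hu0 : 0 < u := hb.trans hu.1
      rw [Real.norm_eq_abs, abs_div, abs_of_pos (pow_pos hu0 2)]
      gcongr
      exact abs_dampedCos_le_one s ha hu0.le) hc.intervalIntegrable
  rw [hfund] at h
  rw [← Real.norm_eq_abs]
  have : 0 < x⁻¹ := inv_pos.2 hx
  rw [one_div]
  linarith

lemma primeSum_eq_sum_Icc (g : ℕ → ℂ) (t : ℝ) :
    primeSum g t = ∑ k ∈ Finset.Icc 0 ⌊t⌋₊, if k.Prime then g k else 0 := by
  rw [primeSum, Nat.primesBelow, Finset.sum_filter, Nat.range_succ_eq_Icc_zero]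

lemma div_log_le_self {t : ℝ} (ht : 3 ≤ t) : t / Real.log t ≤ t :=
  div_le_self (by linarith)
    ((Real.le_log_iff_exp_le (by linarith)).2 (by linarith [Real.exp_one_lt_d9]))

lemma norm_primeSum_le (g : ℕ → ℂ) {t T : ℝ} (h : t ≤ T) :
    ‖primeSum g t‖ ≤ ∑ p ∈ Nat.primesBelow (⌊T⌋₊ + 1), ‖g p‖ := by
  refine (norm_sum_le _ _).trans (Finset.sum_le_sum_of_subset_of_nonneg (fun p hp => ?_)
    fun _ _ _ => norm_nonneg _)
  rw [Nat.mem_primesBelow] at hp ⊢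
  exact ⟨hp.1.trans_le (Nat.succ_le_succ (Nat.floor_le_floor h)), hp.2⟩

lemma exists_norm_primeSum_sub_le (θ : ℂ) (g : ℕ → ℂ)
    (hsmall : Tendsto (fun t : ℝ =>
        (primeSum g t - θ * (t / Real.log t)) / ((t / Real.log t : ℝ) : ℂ))
      atTop (nhds 0)) :
    ∃ K : ℝ, 0 ≤ K ∧ ∀ t : ℝ, 3 ≤ t → ‖primeSum g t - θ * (t / Real.log t)‖ ≤ K * t := by
  obtain ⟨T, hT⟩ := eventually_atTop.1
    (hsmall.norm.eventually (ge_mem_nhds (by simp : ‖(0 : ℂ)‖ < 1)))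
  have hS : 0 ≤ ∑ p ∈ Nat.primesBelow (⌊T⌋₊ + 1), ‖g p‖ :=
    Finset.sum_nonneg fun _ _ => norm_nonneg _
  refine ⟨1 + (∑ p ∈ Nat.primesBelow (⌊T⌋₊ + 1), ‖g p‖) + ‖θ‖, by positivity, fun t ht => ?_⟩
  have ht0 : 0 < t := by linarith
  have hq : 0 < t / Real.log t := div_pos ht0 (Real.log_pos (by linarith))
  have hqt := div_log_le_self ht
  rcases le_total T t with h | h
  · have h₁ := hT t h
    rw [norm_div, Complex.norm_of_nonneg hq.le, div_le_one hq] at h₁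
    have : 0 ≤ ((∑ p ∈ Nat.primesBelow (⌊T⌋₊ + 1), ‖g p‖) + ‖θ‖) * t := by positivity
    linarith
  · have h₁ : ‖θ * ((t : ℂ) / (Real.log t : ℂ))‖ ≤ ‖θ‖ * t := by
      rw [norm_mul, ← Complex.ofReal_div, Complex.norm_of_nonneg hq.le]
      gcongr
    have h₂ := norm_primeSum_le g h
    have h₃ := mul_le_mul_of_nonneg_left (by linarith : 1 ≤ t) hS
    linarith [norm_sub_le (primeSum g t) (θ * ((t : ℂ) / (Real.log t : ℂ)))]

lemma rpow_mul_cos_log_eq {x : ℝ} (a s : ℝ) (hx : 0 < x) :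
    x ^ (-(1 + a)) * Real.cos (s * Real.log x) = dampedCos a s (Real.log x) / x := by
  rw [neg_add, Real.rpow_add hx, Real.rpow_neg_one, Real.rpow_def_of_pos hx, dampedCos]
  ring_nf

lemma continuousOn_deriv_weight (a s y : ℝ) :
    ContinuousOn (fun t => (dampedCosDeriv a s (Real.log t) - dampedCos a s (Real.log t)) / t ^ 2)
      (Set.Icc 2 y) := by
  have h0 : ∀ t ∈ Set.Icc 2 y, t ≠ 0 := fun t ht => by linarith [ht.1]
  have hlog : ContinuousOn Real.log (Set.Icc 2 y) := Real.continuousOn_log.mono h0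
  exact (((continuous_dampedCosDeriv a s).comp_continuousOn hlog).sub
    ((continuous_dampedCos a s).comp_continuousOn hlog)).div (continuousOn_pow 2)
      fun t ht => pow_ne_zero 2 (h0 t ht)

lemma abs_deriv_weight_le {a t : ℝ} (s : ℝ) (ha : 0 ≤ a) (ht : 1 ≤ t) :
    |(dampedCosDeriv a s (Real.log t) - dampedCos a s (Real.log t)) / t ^ 2|
      ≤ (1 + a + |s|) / t ^ 2 := by
  rw [abs_div, abs_of_pos (by positivity : 0 < t ^ 2)]
  gcongr
  have hl := Real.log_nonneg ht
  linarith [abs_sub (dampedCosDeriv a s (Real.log t)) (dampedCos a s (Real.log t)),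
    abs_dampedCosDeriv_le s ha hl, abs_dampedCos_le_one s ha hl]

lemma integrableOn_deriv_weight (a s y : ℝ) :
    IntegrableOn (fun t : ℝ =>
      (((dampedCosDeriv a s (Real.log t) - dampedCos a s (Real.log t)) / t ^ 2 : ℝ) : ℂ))
      (Set.Icc 2 y) :=
  (Complex.continuous_ofReal.comp_continuousOn (continuousOn_deriv_weight a s y)).integrableOn_Icc

/-- Partial summation for the twisted prime sum. -/
lemma sum_primesBelow_twisted_eq (g : ℕ → ℂ) (a s : ℝ) {y : ℝ} (hy : 2 ≤ y) :
    ∑ p ∈ Nat.primesBelow (⌊y⌋₊ + 1),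
        g p * (((p : ℝ) ^ (-(1 + a)) * Real.cos (s * Real.log p) : ℝ) : ℂ) =
      ((dampedCos a s (Real.log y) / y : ℝ) : ℂ) * primeSum g y -
        ∫ t in (2 : ℝ)..y,
          (((dampedCosDeriv a s (Real.log t) - dampedCos a s (Real.log t)) / t ^ 2 : ℝ) : ℂ) *
            primeSum g t := by
  have hderiv : ∀ t ∈ Set.Icc 2 y,
      HasDerivAt (fun t : ℝ => ((dampedCos a s (Real.log t) / t : ℝ) : ℂ))
        (((dampedCosDeriv a s (Real.log t) - dampedCos a s (Real.log t)) / t ^ 2 : ℝ) : ℂ) t :=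
    fun t ht => (hasDerivAt_dampedCos_log_div a s (by linarith [ht.1])).ofReal_comp
  have habel := sum_mul_eq_sub_integral_mul₁ (fun k => if k.Prime then g k else 0)
    (if_neg Nat.not_prime_zero) (if_neg Nat.not_prime_one) y
    (fun t ht => (hderiv t ht).differentiableAt)
    ((integrableOn_deriv_weight a s y).congr_fun (fun t ht => (hderiv t ht).deriv.symm)
      measurableSet_Icc)
  simp only [← primeSum_eq_sum_Icc] at habel
  rw [intervalIntegral.integral_of_le hy, ← setIntegral_congr_fun measurableSet_Ioc
    fun t ht => congrArg (· * primeSum g t) (hderiv t (Set.Ioc_subset_Icc_self ht)).deriv, ← habel,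
    Nat.primesBelow, Finset.sum_filter, Nat.range_succ_eq_Icc_zero]
  refine Finset.sum_congr rfl fun p _ => ?_
  split_ifs with hp
  · rw [rpow_mul_cos_log_eq a s (Nat.cast_pos.2 hp.pos), mul_comm]
  · simp

lemma abs_smooth_main_term_sub_log_le {a s y : ℝ} (ha : 0 ≤ a) (hy : 2 ≤ y) :
    |dampedCos a s (Real.log y) / Real.log y -
        (∫ t in (2 : ℝ)..y,
          (dampedCosDeriv a s (Real.log t) - dampedCos a s (Real.log t)) / t ^ 2 *
            (t / Real.log t)) -
        Real.log (if s = 0 then Real.log y else min |s|⁻¹ (Real.log y))|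
      ≤ a * Real.log y + (a + |s|) * Real.log 2 + 2 / Real.log 2 +
        |Real.log (Real.log 2)| + 4 := by
  have hl2 : 0 < Real.log 2 := Real.log_pos one_lt_two
  have hly : 0 < Real.log y := Real.log_pos (by linarith)
  rw [integral_deriv_weight_mul_div_log a s hy]
  have h₁ := abs_integral_dampedCos_div_sq_le s ha hl2 (Real.log_le_log two_pos hy)
  have h₂ := abs_integral_dampedCos_div_sub_log_min_le (s := s) ha hl2 hly
  have h₃ : |dampedCos a s (Real.log 2) / Real.log 2| ≤ 1 / Real.log 2 := by
    rw [abs_div, abs_of_pos hl2]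
    gcongr
    exact abs_dampedCos_le_one s ha hl2.le
  have h₄ : 2 / Real.log 2 = 1 / Real.log 2 + 1 / Real.log 2 := by ring
  rw [abs_le] at h₁ h₂ h₃ ⊢
  constructor <;> linarith [h₁.1, h₁.2, h₂.1, h₂.2, h₃.1, h₃.2]

/-- The contribution of the remainder `E_g` to the integral from partial summation. -/
lemma norm_integral_deriv_weight_mul_le {a s y : ℝ} {E : ℝ → ℂ} (ha : 0 ≤ a) (hy : 2 ≤ y)
    (hE : IntegrableOn (fun t => ‖E t‖ / t ^ 2) (Set.Ioi 2)) :
    ‖∫ t in (2 : ℝ)..y,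
        (((dampedCosDeriv a s (Real.log t) - dampedCos a s (Real.log t)) / t ^ 2 : ℝ) : ℂ) * E t‖
      ≤ (1 + a + |s|) * ∫ t in Set.Ioi (2 : ℝ), ‖E t‖ / t ^ 2 := by
  have hsub : Set.Ioc 2 y ⊆ Set.Ioi (2 : ℝ) := fun t ht => ht.1
  refine (intervalIntegral.norm_integral_le_of_norm_le hy
    (g := fun t => (1 + a + |s|) * (‖E t‖ / t ^ 2)) (Eventually.of_forall fun t ht => ?_)
    ((intervalIntegrable_iff_integrableOn_Ioc_of_le hy).2
      ((hE.mono_set hsub).const_mul _))).trans ?_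
  · rw [norm_mul, Complex.norm_real, Real.norm_eq_abs]
    refine (mul_le_mul_of_nonneg_right (abs_deriv_weight_le s ha (by linarith [ht.1]))
      (norm_nonneg _)).trans_eq ?_
    ring
  · rw [intervalIntegral.integral_const_mul, intervalIntegral.integral_of_le hy]
    exact mul_le_mul_of_nonneg_left (setIntegral_mono_set hE
      (Eventually.of_forall fun t => div_nonneg (norm_nonneg _) (sq_nonneg t))
      (Eventually.of_forall hsub)) (by positivity)

lemma sum_primesBelow_twisted_eq_main_add_remainder (θ : ℂ) (g : ℕ → ℂ) (a s : ℝ) {y : ℝ}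
    (hy : 2 ≤ y) :
    ∑ p ∈ Nat.primesBelow (⌊y⌋₊ + 1),
        g p * (((p : ℝ) ^ (-(1 + a)) * Real.cos (s * Real.log p) : ℝ) : ℂ) =
      θ * ((dampedCos a s (Real.log y) / Real.log y -
        ∫ t in (2 : ℝ)..y,
          (dampedCosDeriv a s (Real.log t) - dampedCos a s (Real.log t)) / t ^ 2 *
            (t / Real.log t) : ℝ) : ℂ) +
      (((dampedCos a s (Real.log y) / y : ℝ) : ℂ) * (primeSum g y - θ * (y / Real.log y)) -
        ∫ t in (2 : ℝ)..y,
          (((dampedCosDeriv a s (Real.log t) - dampedCos a s (Real.log t)) / t ^ 2 : ℝ) : ℂ) *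
            (primeSum g t - θ * (t / Real.log t))) := by
  have hy0 : (y : ℂ) ≠ 0 := Complex.ofReal_ne_zero.2 (by linarith)
  have hmain : ContinuousOn (fun t =>
      (dampedCosDeriv a s (Real.log t) - dampedCos a s (Real.log t)) / t ^ 2 * (t / Real.log t))
      (Set.Icc 2 y) :=
    (continuousOn_deriv_weight a s y).mul (continuousOn_id.div
      (Real.continuousOn_log.mono fun t ht => by simp; linarith [ht.1])
      fun t ht => (Real.log_pos (by linarith [ht.1])).ne')
  have hi₁ : IntervalIntegrable (fun t =>
      (((dampedCosDeriv a s (Real.log t) - dampedCos a s (Real.log t)) / t ^ 2 : ℝ) : ℂ) *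
        primeSum g t) volume 2 y := by
    simp only [primeSum_eq_sum_Icc]
    exact (intervalIntegrable_iff_integrableOn_Icc_of_le hy).2
      (integrableOn_mul_sum_Icc _ zero_le_two (integrableOn_deriv_weight a s y))
  have hi₂ : IntervalIntegrable (fun t =>
      θ * (((dampedCosDeriv a s (Real.log t) - dampedCos a s (Real.log t)) / t ^ 2 *
        (t / Real.log t) : ℝ) : ℂ)) volume 2 y :=
    (continuousOn_const.mul (Complex.continuous_ofReal.comp_continuousOn
      (Set.uIcc_of_le hy ▸ hmain))).intervalIntegrable
  have hsplit := intervalIntegral.integral_sub hi₁ hi₂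
  rw [intervalIntegral.integral_const_mul, intervalIntegral.integral_ofReal] at hsplit
  have hcongr : (∫ t in (2 : ℝ)..y,
      (((dampedCosDeriv a s (Real.log t) - dampedCos a s (Real.log t)) / t ^ 2 : ℝ) : ℂ) *
        (primeSum g t - θ * (t / Real.log t))) = ∫ t in (2 : ℝ)..y,
      ((((dampedCosDeriv a s (Real.log t) - dampedCos a s (Real.log t)) / t ^ 2 : ℝ) : ℂ) *
        primeSum g t - θ * (((dampedCosDeriv a s (Real.log t) - dampedCos a s (Real.log t)) / t ^ 2
          * (t / Real.log t) : ℝ) : ℂ)) :=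
    intervalIntegral.integral_congr fun t _ => by
      push_cast
      ring
  rw [sum_primesBelow_twisted_eq g a s hy, hcongr, hsplit, Complex.ofReal_sub]
  have : ((dampedCos a s (Real.log y) / Real.log y : ℝ) : ℂ) =
      ((dampedCos a s (Real.log y) / y : ℝ) : ℂ) * (y / Real.log y) := by
    push_cast
    field_simp
  rw [this]
  ring

/-- **Twisted prime sums up to `y`.** If `∑_{p ≤ t} g(p) = θ t/log t + E_g(t)` with
`E_g(t) = o(t/log t)` and `∫_2^∞ |E_g(t)| t^{-2} dt < ∞`, then uniformly in `y ≥ 3` and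
in compact ranges of `s ∈ ℝ` and `c ≥ 0`,
`∑_{p ≤ y} g(p) p^{-(1 + c/log y)} cos(s log p) = θ log(min(|s|⁻¹, log y)) + O(1)`
(where for `s = 0` the minimum is interpreted as `log y`). -/
theorem prime_sum_twisted_asymptotic
    (θ : ℂ) (g : ℕ → ℂ)
    (hsmall : Tendsto (fun t : ℝ =>
        (primeSum g t - θ * (t / Real.log t)) / ((t / Real.log t : ℝ) : ℂ))
      atTop (nhds 0))
    (hint : IntegrableOn
      (fun t : ℝ => ‖primeSum g t - θ * (t / Real.log t)‖ / t ^ 2)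
      (Set.Ioi 2) volume) :
    ∀ R : ℝ, 0 < R → ∃ C : ℝ, 0 < C ∧
      ∀ y : ℝ, 3 ≤ y → ∀ s c : ℝ, |s| ≤ R → 0 ≤ c → c ≤ R →
        ‖(∑ p ∈ Nat.primesBelow (⌊y⌋₊ + 1),
            g p * (((p : ℝ) ^ (-(1 + c / Real.log y)) *
              Real.cos (s * Real.log p) : ℝ) : ℂ)) -
          θ * Real.log (if s = 0 then Real.log y else min |s|⁻¹ (Real.log y))‖ ≤ C := by
  intro R hR
  obtain ⟨K, hK, hE⟩ := exists_norm_primeSum_sub_le θ g hsmall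
  set I := ∫ t in Set.Ioi (2 : ℝ), ‖primeSum g t - θ * (t / Real.log t)‖ / t ^ 2 with hI
  have hI0 : 0 ≤ I := setIntegral_nonneg measurableSet_Ioi fun t _ => by positivity
  have hl2 : 0 < Real.log 2 := Real.log_pos one_lt_two
  set B := R + (R + R) * Real.log 2 + 2 / Real.log 2 + |Real.log (Real.log 2)| + 4 with hB
  have hB0 : 0 < B := by positivity
  refine ⟨‖θ‖ * B + K + (1 + R + R) * I + 1, by positivity, fun y hy s c hs hc hcR => ?_⟩
  have hy0 : 0 < y := by linarith
  have hly : 1 ≤ Real.log y :=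
    (Real.le_log_iff_exp_le hy0).2 (by linarith [Real.exp_one_lt_d9])
  have ha : 0 ≤ c / Real.log y := by positivity
  have haR : c / Real.log y ≤ R := (div_le_self hc hly).trans hcR
  have hay : c / Real.log y * Real.log y = c := div_mul_cancel₀ c (by positivity)
  rw [sum_primesBelow_twisted_eq_main_add_remainder θ g _ s (by linarith : 2 ≤ y),
    add_sub_right_comm, ← mul_sub, ← Complex.ofReal_sub]
  have hmain := (abs_smooth_main_term_sub_log_le (s := s) ha (by linarith : 2 ≤ y)).trans
    (show _ ≤ B by rw [hay, hB]; gcongr)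
  have hrem := (norm_integral_deriv_weight_mul_le (s := s) ha (by linarith : 2 ≤ y) hint).trans
    (show _ ≤ (1 + R + R) * I by gcongr)
  have hend : ‖((dampedCos (c / Real.log y) s (Real.log y) / y : ℝ) : ℂ) *
      (primeSum g y - θ * (y / Real.log y))‖ ≤ K := by
    rw [norm_mul, Complex.norm_real, Real.norm_eq_abs, abs_div, abs_of_pos hy0]
    calc _ ≤ 1 / y * (K * y) := by
          gcongr
          · exact abs_dampedCos_le_one s ha (by positivity)
          · exact hE y hy
      _ = K := by field_simp
  refine (norm_add_le _ _).trans ?_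
  rw [norm_mul, Complex.norm_real, Real.norm_eq_abs]
  have h₁ := mul_le_mul_of_nonneg_left hmain (norm_nonneg θ)
  linarith [norm_sub_le (((dampedCos (c / Real.log y) s (Real.log y) / y : ℝ) : ℂ) *
      (primeSum g y - θ * (y / Real.log y))) (∫ t in (2 : ℝ)..y,
        (((dampedCosDeriv (c / Real.log y) s (Real.log t) -
          dampedCos (c / Real.log y) s (Real.log t)) / t ^ 2 : ℝ) : ℂ) *
            (primeSum g t - θ * (t / Real.log t)))]
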